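/- Let m>1 and suppose either (i) p+q = m−1 with p ≥ 0 and q > 0 (region G₅.₁), or (ii) p+q = m−1 with q < 0 and 1 < m < 3 (region G₅.₂ with 1<m<3). Then there exist λ>0, an edge weight μ on the homogeneous tree T_N, and a nonconstant positive function u on T_N such that W_o(n) ≍ e^{λ n} for all n ≥ 2 and u satisfies Δ_m u(x) + u(x)^p·|∇u(x)|^q ≤ 0 at every vertex x of T_N; i.e., (★) admits a nontrivial positive solution on (T_N, μ). -/

import Mathlib

variable {V : Type*}

/-- Vertex measure `μ(x) = ∑_{y} μ_{xy}` of a weighted graph. -/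
noncomputable def vMeasure (μ : V → V → ℝ) (x : V) : ℝ := ∑ᶠ y, μ x y

/-- The `m`-Laplacian on a weighted graph. -/
noncomputable def lapM (μ : V → V → ℝ) (m : ℝ) (u : V → ℝ) (x : V) : ℝ :=
  (vMeasure μ x)⁻¹ * ∑ᶠ y, μ x y * |u y - u x| ^ (m - 2) * (u y - u x)

/-- The norm of the gradient on a weighted graph. -/
noncomputable def gradNorm (μ : V → V → ℝ) (u : V → ℝ) (x : V) : ℝ :=
  Real.sqrt (∑ᶠ y, μ x y / (2 * vMeasure μ x) * (u y - u x) ^ 2)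

open Classical in
/-- `W_o(n)`: the sum of `μ_{xy}` over pairs `(x,y)` with `x ∈ B(o,n)`, `y ∈ V`
and `d(o,x) < d(o,y)`. -/
noncomputable def Wvol (G : SimpleGraph V) (μ : V → V → ℝ) (o : V) (n : ℕ) : ℝ :=
  ∑ᶠ x, ∑ᶠ y, if G.dist o x ≤ n ∧ G.dist o x < G.dist o y then μ x y else 0


theorem aux_unique_closer {V : Type*} {G : SimpleGraph V} (hG : G.IsTree) (z x y₁ y₂ : V)
    (h1 : G.Adj x y₁) (h2 : G.Adj x y₂) (d1 : G.dist z x = G.dist z y₁ + 1)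
    (d2 : G.dist z x = G.dist z y₂ + 1) : y₁ = y₂ := by
  obtain ⟨p, hp⟩ := hG.connected.exists_walk_length_eq_dist z y₁
  obtain ⟨q, hq⟩ := hG.connected.exists_walk_length_eq_dist z y₂
  have a1 : (p.concat h1.symm).IsPath :=
    SimpleGraph.Walk.isPath_of_length_eq_dist _ (by rw [SimpleGraph.Walk.length_concat]; omega)
  have a2 : (q.concat h2.symm).IsPath :=
    SimpleGraph.Walk.isPath_of_length_eq_dist _ (by rw [SimpleGraph.Walk.length_concat]; omega)
  have := (hG.existsUnique_path z x).unique a1 a2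
  obtain ⟨h, -⟩ := SimpleGraph.Walk.concat_inj this
  exact h

theorem aux_exists_closer {V : Type*} {G : SimpleGraph V} (hG : G.IsTree) (z x : V) (hne : x ≠ z) :
    ∃ y, G.Adj x y ∧ G.dist z x = G.dist z y + 1 := by
  obtain ⟨p, hp⟩ := hG.connected.exists_walk_length_eq_dist x z
  cases p with
  | nil => exact absurd rfl hne
  | cons h p' =>
    rename_i y
    refine ⟨y, h, ?_⟩
    have := SimpleGraph.dist_le p'
    rw [SimpleGraph.Walk.length_cons] at hp
    rw [G.dist_comm (u := z), G.dist_comm (u := z)]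
    rcases hG.dist_eq_dist_add_one_of_adj z h with h' | h' <;>
      rw [G.dist_comm (u := z), G.dist_comm (u := z)] at h' <;> omega

theorem aux_ray {V : Type*} {G : SimpleGraph V} {N : ℕ} (hN : 2 ≤ N) (hG : G.IsTree)
    (hreg : ∀ v, (G.neighborSet v).ncard = N) (o : V) :
    ∃ a : ℕ → V, a 0 = o ∧ (∀ n, G.Adj (a n) (a (n+1))) ∧ ∀ n, G.dist o (a n) = n := by
  have step : ∀ x, ∃ y, G.Adj x y ∧ G.dist o y = G.dist o x + 1 := by
    intro x
    by_contra! hcon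
    have h1 : 1 < (G.neighborSet x).ncard := by rw [hreg]; omega
    have hfin : (G.neighborSet x).Finite := Set.finite_of_ncard_pos (by omega)
    obtain ⟨y, hy, z, hz, hyz⟩ := (Set.one_lt_ncard hfin).1 h1
    refine hyz (aux_unique_closer hG o x y z hy hz ?_ ?_)
    · have := hcon y hy
      have := hG.dist_eq_dist_add_one_of_adj o hy
      omega
    · have := hcon z hz
      have := hG.dist_eq_dist_add_one_of_adj o hz
      omega
  choose f hf hd using step
  refine ⟨fun n => f^[n] o, rfl, fun n => ?_, fun n => ?_⟩
  · simp only [Function.iterate_succ_apply']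
    exact hf _
  · induction n with
    | zero => simp
    | succ n ih => simp only [Function.iterate_succ_apply']; rw [hd, ih]

theorem aux_horo {V : Type*} {G : SimpleGraph V} {N : ℕ} (hN : 2 ≤ N) (hG : G.IsTree)
    (hreg : ∀ v, (G.neighborSet v).ncard = N) (o : V) :
    ∃ h : V → ℤ, h o = 0 ∧ (∀ x, h x ≤ G.dist o x) ∧
      (∀ x y, G.Adj x y → h y = h x + 1 ∨ h y = h x - 1) ∧
      (∀ x, ∃! y, G.Adj x y ∧ h y = h x - 1) := by
  obtain ⟨a, a0, aadj, ad⟩ := aux_ray hN hG hreg o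
  have ex : ∀ x, ∃ k : ℤ, ∃ M : ℕ, ∀ n, M ≤ n → (G.dist (a n) x : ℤ) = k + n := by
    intro x
    have tri : ∀ n, n ≤ G.dist o x + G.dist (a n) x := by
      intro n
      have := hG.connected.dist_triangle (u := o) (v := x) (w := a n)
      rw [ad, G.dist_comm (u := x)] at this
      exact this
    have hanti : Antitone (fun n => G.dist o x + G.dist (a n) x - n) := by
      apply antitone_nat_of_succ_le
      intro n
      have h := hG.dist_eq_dist_add_one_of_adj x (aadj n)
      rw [G.dist_comm (u := x), G.dist_comm (u := x)] at h
      have := tri n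
      have := tri (n+1)
      omega
    obtain ⟨M, hM⟩ := WellFoundedLT.antitone_chain_condition hanti
    refine ⟨(G.dist (a M) x : ℤ) - M, M, fun n hn => ?_⟩
    have := hM n hn
    have h1 := tri n
    have h2 := tri M
    change G.dist o x + G.dist (a M) x - M = G.dist o x + G.dist (a n) x - n at this
    omega
  choose h M hM using ex
  refine ⟨h, ?_, ?_, ?_, ?_⟩
  · have := hM o (M o) le_rfl
    rw [G.dist_comm, ad] at this
    omega
  · intro x
    have h1 := hM x (M x) le_rfl
    have := hG.connected.dist_triangle (u := a (M x)) (v := o) (w := x)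
    rw [G.dist_comm (u := a (M x)) (v := o), ad] at this
    omega
  · intro x y hxy
    have h1 := hM x (max (M x) (M y)) (le_max_left _ _)
    have h2 := hM y (max (M x) (M y)) (le_max_right _ _)
    have := hG.dist_eq_dist_add_one_of_adj (a (max (M x) (M y))) hxy
    omega
  · intro x
    apply existsUnique_of_exists_of_unique
    · have hfin : (G.neighborSet x).Finite := Set.finite_of_ncard_pos (by rw [hreg]; omega)
      obtain ⟨B, hB⟩ := (hfin.image M).bddAbove
      set n := max (max (M x) B) (G.dist o x + 1) with hn
      have hne : x ≠ a n := by
        intro he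
        have := ad n
        rw [← he] at this
        omega
      obtain ⟨y, hy, hd⟩ := aux_exists_closer hG (a n) x hne
      refine ⟨y, hy, ?_⟩
      have h1 := hM x n (by omega)
      have h2 := hM y n (by
        have : M y ≤ B := hB (Set.mem_image_of_mem M hy)
        omega)
      omega
    · rintro y z ⟨hy, hy'⟩ ⟨hz, hz'⟩
      set n := max (max (M x) (M y)) (M z)
      have h1 := hM x n (by omega)
      have h2 := hM y n (by omega)
      have h3 := hM z n (by omega)
      exact aux_unique_closer hG (a n) x y z hy hz (by omega) (by omega)
open Filter Topology in

theorem aux_param (m p q B : ℝ) (hm : 1 < m)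
    (hregion : (0 ≤ p ∧ 0 < q) ∨ (q < 0 ∧ m < 3)) :
    ∃ K r : ℝ, 1 < K ∧ B ≤ r ∧ 0 < r ∧
      Real.sqrt ((K^2 + r) / (2 * (1 + r))) ^ q ≤
        (1 - K⁻¹) ^ p * ((r - K ^ (m-1)) / (1 + r)) := by
  have hth : ∀ p : ℝ, Tendsto (fun K : ℝ => (1 - K⁻¹) ^ p) atTop (𝓝 1) := by
    intro p
    have h1 : Tendsto (fun K : ℝ => (1 - K⁻¹)) atTop (𝓝 1) := by
      simpa using tendsto_const_nhds.sub (tendsto_inv_atTop_zero (𝕜 := ℝ))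
    simpa using h1.rpow_const (p := p) (Or.inl one_ne_zero)
  rcases hregion with ⟨hp, hq⟩ | ⟨hq, hm3⟩
  · have hlt : Real.sqrt (1/2) ^ q < 1 := by
      apply Real.rpow_lt_one (Real.sqrt_nonneg _) _ hq
      rw [Real.sqrt_lt' one_pos]; norm_num
    obtain ⟨K, hK1, hK⟩ := ((eventually_gt_atTop (1:ℝ)).and
      ((hth p).eventually (lt_mem_nhds hlt))).exists
    have hinv : Tendsto (fun r : ℝ => (1 + r)⁻¹) atTop (𝓝 0) :=
      (tendsto_atTop_add_const_left _ _ tendsto_id).inv_tendsto_atTop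
    have hl : ∀ c : ℝ, Tendsto (fun r : ℝ => (c + r) / (1 + r)) atTop (𝓝 1) := by
      intro c
      have : Tendsto (fun r : ℝ => 1 + (c - 1) * (1 + r)⁻¹) atTop (𝓝 (1 + (c-1) * 0)) :=
        tendsto_const_nhds.add (tendsto_const_nhds.mul hinv)
      rw [mul_zero, add_zero] at this
      refine this.congr' ?_
      filter_upwards [eventually_gt_atTop 0] with r hr
      field_simp
      ring
    have hL : Tendsto (fun r : ℝ => Real.sqrt ((K^2 + r) / (2 * (1 + r))) ^ q) atTop
        (𝓝 (Real.sqrt (1/2) ^ q)) := by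
      have h1 : Tendsto (fun r : ℝ => ((K^2 + r) / (2 * (1 + r)))) atTop (𝓝 (1/2)) := by
        refine ((hl (K^2)).div_const 2).congr (fun r => ?_)
        rw [div_div, mul_comm (1+r) 2]
      exact h1.sqrt.rpow_const (Or.inr hq.le)
    have hR : Tendsto (fun r : ℝ => (1 - K⁻¹) ^ p * ((r - K ^ (m-1)) / (1 + r))) atTop
        (𝓝 ((1 - K⁻¹) ^ p)) := by
      have h1 := (hl (-K^(m-1))).const_mul ((1 - K⁻¹) ^ p)
      rw [mul_one] at h1
      refine h1.congr (fun r => ?_)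
      rw [neg_add_eq_sub]
    obtain ⟨r, h1, h2, h3⟩ := ((hL.eventually_lt hR hK).and
      ((eventually_ge_atTop B).and (eventually_gt_atTop 0))).exists
    exact ⟨K, r, hK1, h2, h3, h1.le⟩
  · have hr : Tendsto (fun K : ℝ => 2 * K ^ (m-1)) atTop atTop :=
      (tendsto_rpow_atTop (by linarith)).const_mul_atTop two_pos
    have hQ : Tendsto (fun K : ℝ => (K^2 + 2 * K ^ (m-1)) / (2 * (1 + 2 * K ^ (m-1)))) atTop atTop := by
      have h1 : Tendsto (fun K : ℝ => (1/6) * K ^ (3 - m)) atTop atTop :=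
        (tendsto_rpow_atTop (by linarith)).const_mul_atTop (by norm_num)
      refine tendsto_atTop_mono' _ ?_ h1
      filter_upwards [eventually_ge_atTop 1] with K hK
      have hK0 : 0 < K := by linarith
      have h2 : 1 ≤ K ^ (m-1) := Real.one_le_rpow hK (by linarith)
      have h3 : K ^ (3-m) * K ^ (m-1) = K^2 := by
        rw [← Real.rpow_add hK0, ← Real.rpow_natCast]; congr 1; push_cast; ring
      have h4 : 0 < K ^ (3-m) := Real.rpow_pos_of_pos hK0 _
      rw [le_div_iff₀ (by positivity)]
      nlinarith
    have hL : Tendsto (fun K : ℝ => Real.sqrt ((K^2 + 2 * K ^ (m-1)) / (2 * (1 + 2 * K ^ (m-1)))) ^ q)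
        atTop (𝓝 0) := by
      have := (tendsto_rpow_neg_atTop (y := -q) (by linarith)).comp
        (Real.tendsto_sqrt_atTop.comp hQ)
      simpa [Function.comp_def] using this
    obtain ⟨K, h1, h2, h3, h4⟩ := ((hL.eventually (gt_mem_nhds (show (0:ℝ) < 1/6 by norm_num))).and
      (((hth p).eventually (lt_mem_nhds (show (1/2:ℝ) < 1 by norm_num))).and
      ((eventually_gt_atTop (1:ℝ)).and (hr.eventually_ge_atTop B)))).exists
    have h2' : 1 ≤ K ^ (m-1) := Real.one_le_rpow h3.le (by linarith)
    refine ⟨K, _, h3, h4, by positivity, h1.le.trans ?_⟩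
    have : (1/3:ℝ) ≤ (2 * K ^ (m-1) - K ^ (m-1)) / (1 + 2 * K ^ (m-1)) := by
      rw [div_le_div_iff₀ (by norm_num) (by positivity)]
      linarith
    calc (1/6:ℝ) = 1/2 * (1/3) := by norm_num
      _ ≤ _ := mul_le_mul h2.le this (by norm_num) (by linarith)

theorem aux_finsum {V : Type*} {G : SimpleGraph V} {N : ℕ} (hN : 2 ≤ N)
    (hreg : ∀ v, (G.neighborSet v).ncard = N) (h : V → ℤ)
    (hadj : ∀ x y, G.Adj x y → h y = h x + 1 ∨ h y = h x - 1)
    (hpar : ∀ x, ∃! y, G.Adj x y ∧ h y = h x - 1) (x : V) (F : V → ℝ) (a c : ℝ)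
    (h0 : ∀ y, ¬ G.Adj x y → F y = 0) (h1 : ∀ y, G.Adj x y → h y = h x - 1 → F y = a)
    (h2 : ∀ y, G.Adj x y → h y = h x + 1 → F y = c) :
    ∑ᶠ y, F y = a + ((N:ℝ) - 1) * c := by
  classical
  have hfin : (G.neighborSet x).Finite := Set.finite_of_ncard_pos (by rw [hreg]; omega)
  obtain ⟨z, ⟨hz, hz'⟩, hu⟩ := hpar x
  have hzs : z ∈ hfin.toFinset := by simpa using hz
  have hs : Function.support F ⊆ (hfin.toFinset : Set V) := by
    intro y hy
    by_contra hcon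
    exact hy (h0 y (by simpa using hcon))
  rw [finsum_eq_sum_of_support_subset _ hs, ← Finset.add_sum_erase _ _ hzs, h1 z hz hz']
  have : ∀ y ∈ hfin.toFinset.erase z, F y = c := by
    intro y hy
    rw [Finset.mem_erase] at hy
    have hy2 : G.Adj x y := by simpa using hy.2
    rcases hadj x y hy2 with h' | h'
    · exact h2 y hy2 h'
    · exact absurd (hu y ⟨hy2, h'⟩) hy.1
  rw [Finset.sum_congr rfl this, Finset.sum_const, Finset.card_erase_of_mem hzs,
    ← Set.ncard_eq_toFinset_card _ hfin, hreg, nsmul_eq_mul, Nat.cast_sub (by omega)]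
  simp

open Classical in
/-- Horocyclic edge weight. -/
noncomputable def horoWeight {V : Type*} (G : SimpleGraph V) (h : V → ℤ) (b : ℝ) (x y : V) : ℝ :=
  if G.Adj x y then b ^ max (h x) (h y) else 0

theorem horoWeight_symm {V : Type*} (G : SimpleGraph V) (h : V → ℤ) (b : ℝ) (x y : V) :
    horoWeight G h b x y = horoWeight G h b y x := by
  unfold horoWeight
  rw [max_comm]
  by_cases hxy : G.Adj x y
  · rw [if_pos hxy, if_pos hxy.symm]
  · rw [if_neg hxy, if_neg (fun hc => hxy hc.symm)]

theorem horoWeight_of_not {V : Type*} (G : SimpleGraph V) (h : V → ℤ) (b : ℝ) (x y : V)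
    (hn : ¬ G.Adj x y) : horoWeight G h b x y = 0 := by
  unfold horoWeight
  rw [if_neg hn]

theorem horoWeight_pos {V : Type*} (G : SimpleGraph V) (h : V → ℤ) (b : ℝ) (hb : 0 < b) (x y : V)
    (hn : G.Adj x y) : 0 < horoWeight G h b x y := by
  unfold horoWeight
  rw [if_pos hn]
  positivity

theorem horoWeight_nonneg {V : Type*} (G : SimpleGraph V) (h : V → ℤ) (b : ℝ) (hb : 0 < b)
    (x y : V) : 0 ≤ horoWeight G h b x y := by
  unfold horoWeight
  split_ifs <;> positivity

theorem horoWeight_par {V : Type*} (G : SimpleGraph V) (h : V → ℤ) (b : ℝ) (x y : V)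
    (hn : G.Adj x y) (hh : h y = h x - 1) : horoWeight G h b x y = b ^ (h x) := by
  unfold horoWeight
  rw [if_pos hn, max_eq_left (by omega)]

theorem horoWeight_child {V : Type*} (G : SimpleGraph V) (h : V → ℤ) (b : ℝ) (hb : 0 < b) (x y : V)
    (hn : G.Adj x y) (hh : h y = h x + 1) : horoWeight G h b x y = b ^ (h x) * b := by
  unfold horoWeight
  rw [if_pos hn, max_eq_right (by omega), hh, zpow_add_one₀ hb.ne']

theorem aux_local {V : Type*} {G : SimpleGraph V} {N : ℕ} (hN : 2 ≤ N)
    (hreg : ∀ v, (G.neighborSet v).ncard = N) (h : V → ℤ)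
    (hadj : ∀ x y, G.Adj x y → h y = h x + 1 ∨ h y = h x - 1)
    (hpar : ∀ x, ∃! y, G.Adj x y ∧ h y = h x - 1)
    (m p q K r : ℝ) (hpq : p + q = m - 1) (hK : 1 < K) (hr : 0 < r)
    (hineq : Real.sqrt ((K^2 + r) / (2 * (1 + r))) ^ q ≤
        (1 - K⁻¹) ^ p * ((r - K ^ (m-1)) / (1 + r))) (x : V) :
    0 < gradNorm (horoWeight G h (r / (N - 1))) (fun x => K ^ (- h x)) x ∧
    lapM (horoWeight G h (r / (N - 1))) m (fun x => K ^ (- h x)) x +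
      (fun x => K ^ (- h x)) x ^ p * gradNorm (horoWeight G h (r / (N - 1))) (fun x => K ^ (- h x)) x ^ q ≤ 0 := by
  have hN1 : (0:ℝ) < N - 1 := by
    have : (2:ℝ) ≤ N := by exact_mod_cast hN
    linarith
  set b : ℝ := r / (N - 1) with hbdef
  have hb : 0 < b := by positivity
  have hbr : ((N:ℝ) - 1) * b = r := by rw [hbdef]; field_simp
  have hK0 : 0 < K := by linarith
  set w := b ^ h x with hw
  have hw0 : 0 < w := by positivity
  set U : ℝ := K ^ (- h x) with hU
  have hU0 : 0 < U := by positivity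
  set θ : ℝ := 1 - K⁻¹ with hθ
  have hθ0 : 0 < θ := by
    have := inv_lt_one_of_one_lt₀ hK
    rw [hθ]; linarith
  have up : ∀ y, h y = h x - 1 → (K ^ (- h y) - U : ℝ) = K * (θ * U) := by
    intro y hy
    rw [hy, show -(h x - 1) = - h x + 1 by ring, zpow_add_one₀ hK0.ne', ← hU, hθ]
    field_simp
  have dn : ∀ y, h y = h x + 1 → (K ^ (- h y) - U : ℝ) = - (θ * U) := by
    intro y hy
    rw [hy, show -(h x + 1) = - h x - 1 by ring, zpow_sub_one₀ hK0.ne', ← hU, hθ]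
    ring
  have vM : vMeasure (horoWeight G h b) x = w * (1 + r) := by
    unfold vMeasure
    rw [aux_finsum hN hreg h hadj hpar x _ w (w * b) (fun y hy => horoWeight_of_not G h b x y hy)
      (fun y hy hh => horoWeight_par G h b x y hy hh)
      (fun y hy hh => horoWeight_child G h b hb x y hy hh), ← hbr]
    ring
  have hD : 0 < θ * U := by positivity
  have hrp : ∀ d : ℝ, 0 < d → |d| ^ (m - 2) * d = d ^ (m - 1) := by
    intro d hd
    rw [abs_of_pos hd, ← Real.rpow_add_one hd.ne']
    congr 1; ring
  have lap : lapM (horoWeight G h b) m (fun x => K ^ (- h x)) x =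
      (θ * U) ^ (m-1) * ((K ^ (m-1) - r) / (1 + r)) := by
    unfold lapM
    rw [vM, aux_finsum hN hreg h hadj hpar x _ (w * (K * (θ * U)) ^ (m-1))
      (- (w * b * (θ * U) ^ (m-1)))]
    · rw [Real.mul_rpow hK0.le hD.le, ← hbr]
      field_simp
      ring
    · intro y hy
      rw [horoWeight_of_not G h b x y hy]; ring
    · intro y hy hh
      simp only
      rw [horoWeight_par G h b x y hy hh, ← hU, up y hh, mul_assoc, hrp _ (by positivity)]
    · intro y hy hh
      simp only
      rw [horoWeight_child G h b hb x y hy hh, ← hU, dn y hh, mul_assoc, abs_neg, mul_neg,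
        hrp _ (by positivity)]
      ring
  have grad : gradNorm (horoWeight G h b) (fun x => K ^ (- h x)) x =
      (θ * U) * Real.sqrt ((K^2 + r) / (2 * (1 + r))) := by
    unfold gradNorm
    rw [vM, aux_finsum hN hreg h hadj hpar x _ (w / (2 * (w * (1 + r))) * (K * (θ * U)) ^ 2)
      (w * b / (2 * (w * (1 + r))) * (θ * U) ^ 2)]
    · rw [← Real.sqrt_sq hD.le, ← Real.sqrt_mul (by positivity), Real.sqrt_sq hD.le]
      congr 1
      rw [← hbr]
      have : (0:ℝ) < 1 + (N - 1) * b := by positivity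
      field_simp
    · intro y hy
      rw [horoWeight_of_not G h b x y hy]; ring
    · intro y hy hh
      simp only
      rw [horoWeight_par G h b x y hy hh, ← hU, up y hh]
    · intro y hy hh
      simp only
      rw [horoWeight_child G h b hb x y hy hh, ← hU, dn y hh, neg_sq]
  refine ⟨by rw [grad]; positivity, ?_⟩
  rw [lap, grad]
  simp only
  rw [← hU, Real.mul_rpow hD.le (Real.sqrt_nonneg _)]
  have e1 : (θ * U) ^ (m-1) = U ^ p * (θ * U) ^ q * θ ^ p := by
    rw [← hpq, Real.rpow_add hD, Real.mul_rpow hθ0.le hU0.le (z := p)]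
    ring
  have e2 : U ^ p * (θ * U) ^ q * Real.sqrt ((K^2 + r) / (2 * (1 + r))) ^ q ≤
      U ^ p * (θ * U) ^ q * (θ ^ p * ((r - K ^ (m-1)) / (1 + r))) :=
    mul_le_mul_of_nonneg_left hineq (by positivity)
  have e3 : (K ^ (m-1) - r) / (1 + r) = - ((r - K ^ (m-1)) / (1 + r)) := by ring
  rw [e1, e3]
  linarith

theorem aux_sphere {V : Type*} {G : SimpleGraph V} {N : ℕ} (hN : 2 ≤ N) (hG : G.IsTree)
    (hreg : ∀ v, (G.neighborSet v).ncard = N) (o : V) (n : ℕ) :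
    {x | G.dist o x = n}.Finite := by
  have hfin : ∀ x, (G.neighborSet x).Finite :=
    fun x => Set.finite_of_ncard_pos (by rw [hreg]; omega)
  induction n with
  | zero =>
    refine (Set.finite_singleton o).subset ?_
    intro x hx
    exact ((hG.connected.dist_eq_zero_iff).1 hx).symm
  | succ n ih =>
    refine (ih.biUnion (fun x _ => hfin x)).subset ?_
    intro x hx
    have hx' : G.dist o x = n + 1 := hx
    have hne : x ≠ o := by
      rintro rfl
      simp at hx'
    obtain ⟨y, hy, hd⟩ := aux_exists_closer hG o x hne
    simp only [Set.mem_iUnion]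
    refine ⟨y, ?_, hy.symm⟩
    change G.dist o y = n
    omega

theorem aux_Wvol {V : Type*} {G : SimpleGraph V} (hG : G.IsTree)
    (o : V) (S : ℕ → Finset V) (hS : ∀ n x, x ∈ S n ↔ G.dist o x = n)
    (μ : V → V → ℝ) (h0 : ∀ x y, ¬ G.Adj x y → μ x y = 0) (n : ℕ) :
    Wvol G μ o n = ∑ k ∈ Finset.range (n+1), ∑ x ∈ S k, ∑ y ∈ S (k+1), μ x y := by
  classical
  unfold Wvol
  have inner : ∀ x, (∑ᶠ y, if G.dist o x ≤ n ∧ G.dist o x < G.dist o y then μ x y else 0) =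
      if G.dist o x ≤ n then ∑ y ∈ S (G.dist o x + 1), μ x y else 0 := by
    intro x
    split_ifs with hx
    · rw [finsum_eq_sum_of_support_subset (s := S (G.dist o x + 1))]
      · apply Finset.sum_congr rfl
        intro y hy
        rw [hS] at hy
        rw [if_pos ⟨hx, by omega⟩]
      · intro y hy
        rw [Function.mem_support] at hy
        have h1 : G.dist o x < G.dist o y := by
          by_contra hc
          exact hy (if_neg (fun h => hc h.2))
        have h2 : G.Adj x y := by
          by_contra hc
          rw [h0 x y hc] at hy
          simp at hy
        have := hG.dist_eq_dist_add_one_of_adj o h2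
        simp only [Finset.mem_coe, hS]
        omega
    · simp [hx]
  simp_rw [inner]
  have hdisj : Set.PairwiseDisjoint (↑(Finset.range (n+1))) S := by
    intro i _ j _ hij
    rw [Function.onFun, Finset.disjoint_left]
    intro x hx hx'
    rw [hS] at hx hx'
    omega
  rw [finsum_eq_sum_of_support_subset (s := (Finset.range (n+1)).biUnion S),
    Finset.sum_biUnion hdisj]
  · apply Finset.sum_congr rfl
    intro k hk
    apply Finset.sum_congr rfl
    intro x hx
    rw [hS] at hx
    rw [Finset.mem_range] at hk
    rw [if_pos (by omega), hx]
  · intro x hx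
    rw [Function.mem_support] at hx
    have : G.dist o x ≤ n := by
      by_contra hc
      exact hx (if_neg hc)
    simp only [Finset.coe_biUnion, Set.mem_iUnion, Finset.mem_coe, hS, Finset.mem_range]
    exact ⟨_, by omega, rfl⟩

theorem aux_volume {V : Type*} {G : SimpleGraph V} {N : ℕ} (hN : 2 ≤ N) (hG : G.IsTree)
    (hreg : ∀ v, (G.neighborSet v).ncard = N) (o : V) (h : V → ℤ) (ho : h o = 0)
    (hle : ∀ x, h x ≤ G.dist o x)
    (hadj : ∀ x y, G.Adj x y → h y = h x + 1 ∨ h y = h x - 1)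
    (hpar : ∀ x, ∃! y, G.Adj x y ∧ h y = h x - 1)
    (r : ℝ) (hr : 2 * N ≤ r) :
    ∃ C : ℝ, 0 < C ∧ ∀ n : ℕ, r ^ n ≤ Wvol G (horoWeight G h (r / (N - 1))) o n ∧
      Wvol G (horoWeight G h (r / (N - 1))) o n ≤ C * r ^ n := by
  classical
  have hN2 : (2:ℝ) ≤ N := by exact_mod_cast hN
  have hN1 : (0:ℝ) < N - 1 := by linarith
  have hr0 : 0 < r := by linarith
  set b : ℝ := r / (N - 1) with hbdef
  have hb : 0 < b := by positivity
  have hbr : ((N:ℝ) - 1) * b = r := by rw [hbdef]; field_simp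
  set μ := horoWeight G h b with hμ
  have μ0 : ∀ x y, 0 ≤ μ x y := horoWeight_nonneg G h b hb
  have hfin : ∀ x, (G.neighborSet x).Finite :=
    fun x => Set.finite_of_ncard_pos (by rw [hreg]; omega)
  set S : ℕ → Finset V := fun n => (aux_sphere hN hG hreg o n).toFinset with hSdef
  have hS : ∀ n x, x ∈ S n ↔ G.dist o x = n := by
    intro n x
    simp [hSdef]
  set L : ℕ → ℝ := fun k => ∑ x ∈ S k, ∑ y ∈ S (k+1), μ x y with hL
  have hW : ∀ n, Wvol G μ o n = ∑ k ∈ Finset.range (n+1), L k :=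
    fun n => aux_Wvol hG o S hS μ (horoWeight_of_not G h b) n
  have L0 : ∀ k, 0 ≤ L k := fun k => Finset.sum_nonneg fun x _ => Finset.sum_nonneg fun y _ => μ0 x y
  have vM : ∀ x, ∑ᶠ y, μ x y = b ^ (h x) * (1 + r) := by
    intro x
    rw [aux_finsum hN hreg h hadj hpar x _ (b ^ h x) (b ^ h x * b)
      (fun y hy => horoWeight_of_not G h b x y hy)
      (fun y hy hh => horoWeight_par G h b x y hy hh)
      (fun y hy hh => horoWeight_child G h b hb x y hy hh), ← hbr]
    ring
  -- upper recursion
  have key : ∀ k, ∀ x ∈ S (k+1), ∑ y ∈ S (k+2), μ x y ≤ r * ∑ z ∈ S k, μ z x := by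
    intro k x hx
    have hx' : G.dist o x = k + 1 := (hS _ _).1 hx
    have hne : x ≠ o := by
      rintro rfl
      simp at hx'
    obtain ⟨z, hz, hd⟩ := aux_exists_closer hG o x hne
    have hzS : z ∈ S k := (hS _ _).2 (by omega)
    have hin : μ z x ≤ ∑ z ∈ S k, μ z x :=
      Finset.single_le_sum (f := fun z => μ z x) (fun y _ => μ0 y x) hzS
    have hsymm : ∑ z ∈ S k, μ z x = ∑ z ∈ S k, μ x z :=
      Finset.sum_congr rfl fun y _ => horoWeight_symm G h b y x
    have hdis : Disjoint (S (k+2)) (S k) := by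
      rw [Finset.disjoint_left]
      intro y hy hy'
      rw [hS] at hy hy'
      omega
    have htot : ∑ y ∈ S (k+2), μ x y + ∑ z ∈ S k, μ x z ≤ b ^ (h x) * (1 + r) := by
      rw [← Finset.sum_union hdis, ← vM x,
        finsum_eq_sum_of_support_subset (s := (S (k+2) ∪ S k) ∪ (hfin x).toFinset)]
      · exact Finset.sum_le_sum_of_subset_of_nonneg Finset.subset_union_left
          (fun y _ _ => μ0 x y)
      · intro y hy
        have : G.Adj x y := by
          by_contra hc
          exact hy (horoWeight_of_not G h b x y hc)
        simp [this]
    have hin0 : 0 ≤ ∑ z ∈ S k, μ x z := Finset.sum_nonneg fun y _ => μ0 x y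
    rw [hsymm] at hin ⊢
    rw [show μ z x = μ x z from horoWeight_symm G h b z x] at hin
    have hw0 : 0 < b ^ h x := by positivity
    rcases hadj x z hz with hh | hh
    · rw [show μ x z = _ from horoWeight_child G h b hb x z hz hh] at hin
      have h1 : (1 + r) ≤ r * b := by
        rw [hbdef, mul_div_assoc', le_div_iff₀ hN1]
        nlinarith
      have h2 : b ^ h x * (1 + r) ≤ r * (b ^ h x * b) := by nlinarith
      nlinarith
    · rw [show μ x z = _ from horoWeight_par G h b x z hz hh] at hin
      nlinarith
  have hrec : ∀ k, L (k+1) ≤ r * L k := by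
    intro k
    simp only [hL]
    rw [Finset.sum_comm (s := S k), Finset.mul_sum]
    exact Finset.sum_le_sum (key k)
  have Lub : ∀ k, L k ≤ r ^ k * L 0 := by
    intro k
    induction k with
    | zero => simp
    | succ k ih =>
      have := hrec k
      rw [pow_succ']
      nlinarith
  -- lower bound
  set D : ℕ → Finset V := fun n => (S n).filter (fun x => h x = n) with hD
  have hDm : ∀ n x, x ∈ D n ↔ G.dist o x = n ∧ h x = n := by
    intro n x
    simp [hD, hS]
  have out : ∀ k, ∀ x ∈ D k, ∑ y ∈ D (k+1), μ x y = ((N:ℝ) - 1) * b ^ (k+1) := by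
    intro k x hx
    rw [hDm] at hx
    have := aux_finsum hN hreg h hadj hpar x (fun y => if h y = h x + 1 then μ x y else 0)
      0 (b ^ (k+1))
      (fun y hy => by rw [show μ x y = 0 from horoWeight_of_not G h b x y hy, ite_self])
      (fun y hy hh => by rw [if_neg (by omega)])
      (fun y hy hh => by
        rw [if_pos hh, show μ x y = _ from horoWeight_child G h b hb x y hy hh, hx.2, pow_succ,
          zpow_natCast])
    rw [zero_add] at this
    rw [← this, finsum_eq_sum_of_support_subset (s := D (k+1))]
    · apply Finset.sum_congr rfl
      intro y hy
      rw [hDm] at hy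
      rw [if_pos (by have := hy.2; push_cast at this; omega)]
    · intro y hy
      rw [Function.mem_support] at hy
      have h1 : h y = h x + 1 := by
        by_contra hc
        exact hy (if_neg hc)
      have h2 : G.Adj x y := by
        by_contra hc
        rw [show μ x y = 0 from horoWeight_of_not G h b x y hc, ite_self] at hy
        exact hy rfl
      have h3 := hG.dist_eq_dist_add_one_of_adj o h2
      have h4 := hle y
      rw [Finset.mem_coe, hDm]
      push_cast
      omega
  have inn : ∀ k, ∀ y ∈ D (k+1), ∑ x ∈ D k, μ x y ≤ b ^ (k+1) := by
    intro k y hy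
    rw [hDm] at hy
    obtain ⟨z, ⟨hz, hz'⟩, hu⟩ := hpar y
    have h1 : ∑ x ∈ D k, μ x y ≤ ∑ x ∈ insert z (D k), μ x y :=
      Finset.sum_le_sum_of_subset_of_nonneg (Finset.subset_insert _ _) (fun x _ _ => μ0 x y)
    refine h1.trans ?_
    rw [Finset.sum_eq_single z]
    · rw [show μ z y = _ from horoWeight_symm G h b z y, horoWeight_par G h b y z hz hz', hy.2,
        zpow_natCast]
    · intro x hx hxz
      apply horoWeight_of_not
      intro hc
      rcases Finset.mem_insert.1 hx with hx | hx
      · exact hxz hx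
      · rw [hDm] at hx
        refine hxz (hu x ⟨hc.symm, ?_⟩)
        have := hy.2
        push_cast at this
        omega
    · intro hc
      exact absurd (Finset.mem_insert_self _ _) hc
  have card : ∀ k, ((N:ℝ) - 1) ^ k ≤ ((D k).card : ℝ) := by
    intro k
    induction k with
    | zero =>
      have : o ∈ D 0 := by rw [hDm]; simp [ho]
      have : 1 ≤ (D 0).card := Finset.card_pos.2 ⟨o, this⟩
      rw [pow_zero]
      exact_mod_cast this
    | succ k ih =>
      have e1 : ∑ x ∈ D k, ∑ y ∈ D (k+1), μ x y = (D k).card * (((N:ℝ) - 1) * b ^ (k+1)) := by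
        rw [Finset.sum_congr rfl (out k), Finset.sum_const, nsmul_eq_mul]
      have e2 : ∑ x ∈ D k, ∑ y ∈ D (k+1), μ x y ≤ (D (k+1)).card * b ^ (k+1) := by
        rw [Finset.sum_comm]
        refine (Finset.sum_le_sum (inn k)).trans ?_
        rw [Finset.sum_const, nsmul_eq_mul]
      rw [e1, ← mul_assoc] at e2
      have e3 := le_of_mul_le_mul_right e2 (by positivity)
      rw [pow_succ]
      exact (mul_le_mul_of_nonneg_right ih hN1.le).trans e3
  have Llb : ∀ k, r ^ (k+1) ≤ L k := by
    intro k
    have e1 : ∑ x ∈ D k, ∑ y ∈ D (k+1), μ x y = (D k).card * (((N:ℝ) - 1) * b ^ (k+1)) := by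
      rw [Finset.sum_congr rfl (out k), Finset.sum_const, nsmul_eq_mul]
    have e2 : ∑ x ∈ D k, ∑ y ∈ D (k+1), μ x y ≤ L k := by
      refine (Finset.sum_le_sum (fun x _ => Finset.sum_le_sum_of_subset_of_nonneg
        (Finset.filter_subset _ _) (fun y _ _ => μ0 x y))).trans ?_
      exact Finset.sum_le_sum_of_subset_of_nonneg (Finset.filter_subset _ _)
        (fun x _ _ => Finset.sum_nonneg fun y _ => μ0 x y)
    refine le_trans ?_ e2
    rw [e1, ← hbr, mul_pow, pow_succ ((N:ℝ) - 1), mul_assoc]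
    exact mul_le_mul_of_nonneg_right (card k) (by positivity)
  refine ⟨2 * L 0 + 1, by have := L0 0; linarith, fun n => ⟨?_, ?_⟩⟩
  · rw [hW]
    have h1 : L n ≤ ∑ k ∈ Finset.range (n+1), L k :=
      Finset.single_le_sum (f := L) (fun k _ => L0 k) (by simp)
    have h2 := Llb n
    have h3 : r ^ n ≤ r ^ (n+1) := pow_le_pow_right₀ (by linarith) (by omega)
    linarith
  · rw [hW]
    have : ∀ n, ∑ k ∈ Finset.range (n+1), L k ≤ 2 * L 0 * r ^ n := by
      intro n
      induction n with
      | zero => simp; have := L0 0; linarith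
      | succ n ih =>
        rw [Finset.sum_range_succ]
        have h1 := Lub (n+1)
        have h2 : 0 ≤ L 0 * r ^ n := mul_nonneg (L0 0) (by positivity)
        rw [pow_succ] at h1 ⊢
        nlinarith
    have h3 : 0 < r ^ n := by positivity
    have := this n
    linarith

theorem statement15
    (V : Type*) (G : SimpleGraph V) (N : ℕ) (hN : 2 ≤ N)
    (htree : G.IsTree) (hreg : ∀ v, (G.neighborSet v).ncard = N)
    (o : V)
    (m p q : ℝ) (hm : 1 < m)
    (hpq : p + q = m - 1)
    (hregion : (0 ≤ p ∧ 0 < q) ∨ (q < 0 ∧ m < 3)) :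
    ∃ lam : ℝ, 0 < lam ∧ ∃ μ : V → V → ℝ,
      (∀ x y, μ x y = μ y x) ∧
      (∀ x y, 0 < μ x y ↔ G.Adj x y) ∧
      (∀ x y, ¬ G.Adj x y → μ x y = 0) ∧
      ∃ u : V → ℝ,
        (∀ x, 0 < u x) ∧ (∃ x y, u x ≠ u y) ∧
        (∀ x, q < 0 → 0 < gradNorm μ u x) ∧
        (∀ x, lapM μ m u x + u x ^ p * gradNorm μ u x ^ q ≤ 0) ∧
        ∃ c C : ℝ, 0 < c ∧ 0 < C ∧ ∀ n : ℕ, 2 ≤ n →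
          c * (Real.exp (lam * n)) ≤ Wvol G μ o n ∧
          Wvol G μ o n ≤
            C * (Real.exp (lam * n)) := by
  obtain ⟨h, ho, hle, hadj, hpar⟩ := aux_horo hN htree hreg o
  obtain ⟨K, r, hK, hr, hr0, hineq⟩ := aux_param m p q (2 * N) hm hregion
  obtain ⟨C, hC, hvol⟩ := aux_volume hN htree hreg o h ho hle hadj hpar r hr
  have hloc := aux_local hN hreg h hadj hpar m p q K r hpq hK hr0 hineq
  have hN2 : (2:ℝ) ≤ N := by exact_mod_cast hN
  have hN1 : (0:ℝ) < N - 1 := by linarith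
  have hb : 0 < r / ((N:ℝ) - 1) := by positivity
  have hK0 : 0 < K := by linarith
  refine ⟨Real.log r, Real.log_pos (by linarith), horoWeight G h (r / (N - 1)),
    horoWeight_symm G h _, fun x y => ⟨fun hp => ?_, horoWeight_pos G h _ hb x y⟩,
    horoWeight_of_not G h _, fun x => K ^ (- h x), fun x => by positivity, ?_,
    fun x _ => (hloc x).1, fun x => (hloc x).2, 1, C, one_pos, hC, fun n _ => ?_⟩
  · by_contra hc
    rw [horoWeight_of_not G h _ x y hc] at hp
    exact lt_irrefl _ hp
  · obtain ⟨z, ⟨_, hz⟩, _⟩ := hpar o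
    refine ⟨o, z, fun he => ?_⟩
    have := zpow_right_injective₀ hK0 hK.ne' he
    omega
  · have : Real.exp (Real.log r * n) = r ^ n := by
      rw [mul_comm, Real.exp_nat_mul, Real.exp_log hr0]
    rw [this, one_mul]
    exact hvol n
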